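/- arXiv:1105.2874 — 2 statements merged into one kernel-verified Lean document; each statement's English description precedes it below -/
import Mathlib

section
/- Let G be a hole-free and paraglider-free graph, A an induced copy of the complement of C6 in G, and A* a maximal matched co-bipartite induced subgraph of G containing A. Then every vertex of G adjacent to all six vertices of A is adjacent to all vertices of A*. -/
open SimpleGraph

/-- `H` occurs as an induced subgraph of `G`. -/
def HasInducedCopy {V W : Type} (G : SimpleGraph V) (H : SimpleGraph W) : Prop :=
  Nonempty (H ↪g G)

/-- `G` has no induced chordless cycle with at least 5 vertices. -/
def HoleFree {V : Type} (G : SimpleGraph V) : Prop :=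
  ∀ n : ℕ, 5 ≤ n → ¬ HasInducedCopy G (cycleGraph n)

/-- the disjoint union of a `P₂` and a `P₃`. -/
def p2p3 : SimpleGraph (Fin 5) :=
  SimpleGraph.fromRel (fun i j => (i, j) ∈ ([(0,1),(2,3),(3,4)] : List (Fin 5 × Fin 5)))

/-- the paraglider: a diamond on `0,1,2,3` (missing edge `2-3`) plus vertex `4` seeing `2,3`. -/
def paraglider : SimpleGraph (Fin 5) :=
  SimpleGraph.fromRel
    (fun i j => (i, j) ∈ ([(0,1),(0,2),(0,3),(1,2),(1,3),(4,2),(4,3)] : List (Fin 5 × Fin 5)))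

/-- the diamond `K₄ - e`. -/
def diamond : SimpleGraph (Fin 4) :=
  SimpleGraph.fromRel
    (fun i j => (i, j) ∈ ([(0,1),(0,2),(0,3),(1,2),(1,3)] : List (Fin 4 × Fin 4)))

/-- three independent edges. -/
def threeK2 : SimpleGraph (Fin 6) :=
  SimpleGraph.fromRel (fun i j => (i, j) ∈ ([(0,1),(2,3),(4,5)] : List (Fin 6 × Fin 6)))

/-- the matched co-bipartite graph: two cliques of size `k` joined by a perfect matching. -/
def matchedCoBip (k : ℕ) : SimpleGraph (Fin k ⊕ Fin k) :=
  SimpleGraph.fromRel (fun x y =>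
    (∃ i j, x = Sum.inl i ∧ y = Sum.inl j) ∨ (∃ i j, x = Sum.inr i ∧ y = Sum.inr j) ∨
    (∃ i, x = Sum.inl i ∧ y = Sum.inr i))

/-- `G` has no induced hole and no induced antihole. -/
def WeaklyChordal {V : Type} (G : SimpleGraph V) : Prop :=
  ∀ n : ℕ, 5 ≤ n →
    ¬ HasInducedCopy G (cycleGraph n) ∧ ¬ HasInducedCopy G (cycleGraph n)ᶜ

/-- a clique `K` whose removal disconnects the graph. -/
def HasCliqueSeparator {V : Type} (G : SimpleGraph V) : Prop :=
  ∃ K : Set V, G.IsClique K ∧ ¬ (G.induce Kᶜ).Preconnected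

/-- an atom: a connected graph with no clique separator. -/
def IsAtomGraph {V : Type} (G : SimpleGraph V) : Prop :=
  G.Connected ∧ ¬ HasCliqueSeparator G

namespace matchedCoBip

variable {k : ℕ} {i j : Fin k}

@[simp] lemma adj_inl_inl : (matchedCoBip k).Adj (.inl i) (.inl j) ↔ i ≠ j := by
  simp [matchedCoBip]

@[simp] lemma adj_inr_inr : (matchedCoBip k).Adj (.inr i) (.inr j) ↔ i ≠ j := by
  simp [matchedCoBip]

@[simp] lemma adj_inl_inr : (matchedCoBip k).Adj (.inl i) (.inr j) ↔ i = j := by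
  simp [matchedCoBip, eq_comm]

@[simp] lemma adj_inr_inl : (matchedCoBip k).Adj (.inr i) (.inl j) ↔ i = j := by
  rw [SimpleGraph.adj_comm, adj_inl_inr, eq_comm]

/-- A triangle of a matched co-bipartite graph lies within one of the two cliques. -/
lemma isLeft_eq_of_triangle {x y z : Fin k ⊕ Fin k} (hxy : (matchedCoBip k).Adj x y)
    (hxz : (matchedCoBip k).Adj x z) (hyz : (matchedCoBip k).Adj y z) :
    x.isLeft = y.isLeft := by
  rcases x with a | a <;> rcases y with b | b <;> rcases z with c | c <;> simp_all

/-- If `u` is distinct from and not adjacent to `x`, then any neighbour `w` of `x` on the side of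
`u` is the matching partner of `x`. -/
lemma matching_edge {x u w : Fin k ⊕ Fin k} (hne : x ≠ u) (hxu : ¬ (matchedCoBip k).Adj x u)
    (hxw : (matchedCoBip k).Adj x w) (huw : u.isLeft = w.isLeft) :
    ∃ i, (x = .inl i ∧ w = .inr i) ∨ (x = .inr i ∧ w = .inl i) := by
  rcases x with a | a <;> rcases u with b | b <;> rcases w with c | c <;> simp_all

/-- An induced complement of `C₆` contains two of the matching edges. -/
lemma exists_matching_edges (g : (cycleGraph 6)ᶜ ↪g matchedCoBip k) :
    ∃ i j, i ≠ j ∧ .inl i ∈ Set.range g ∧ .inr i ∈ Set.range g ∧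
      .inl j ∈ Set.range g ∧ .inr j ∈ Set.range g := by
  have adj (a b : Fin 6) (h : ((cycleGraph 6)ᶜ).Adj a b) : (matchedCoBip k).Adj (g a) (g b) :=
    g.map_rel_iff.2 h
  have nadj (a b : Fin 6) (h : ¬ ((cycleGraph 6)ᶜ).Adj a b) : ¬ (matchedCoBip k).Adj (g a) (g b) :=
    fun h' => h (g.map_rel_iff.1 h')
  have h13 := isLeft_eq_of_triangle (adj 1 3 (by decide)) (adj 1 5 (by decide))
    (adj 3 5 (by decide))
  have h15 := isLeft_eq_of_triangle (adj 1 5 (by decide)) (adj 1 3 (by decide))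
    (adj 5 3 (by decide))
  obtain ⟨i, hi⟩ := matching_edge (g.injective.ne (by decide)) (nadj 0 1 (by decide))
    (adj 0 3 (by decide)) h13
  obtain ⟨j, hj⟩ := matching_edge (g.injective.ne (by decide)) (nadj 2 1 (by decide))
    (adj 2 5 (by decide)) h15
  have hij : i ≠ j := by
    rintro rfl
    have h02 : g 0 ≠ g 2 := g.injective.ne (by decide)
    have h05 : g 0 ≠ g 5 := g.injective.ne (by decide)
    rcases hi with hi | hi <;> rcases hj with hj | hj <;> simp_all
  refine ⟨i, j, hij, ?_⟩
  rcases hi with hi | hi <;> rcases hj with hj | hj <;>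
    simp only [← hi.1, ← hi.2, ← hj.1, ← hj.2, Set.mem_range_self, and_self]

end matchedCoBip

section

variable {V : Type} {G : SimpleGraph V}

lemma hasInducedCopy_of_adj_iff {W : Type} {H : SimpleGraph W} (φ : W → V)
    (hinj : ∀ i j, i ≠ j → φ i ≠ φ j) (hadj : ∀ i j, G.Adj (φ i) (φ j) ↔ H.Adj i j) :
    HasInducedCopy G H :=
  ⟨⟨⟨φ, fun i j h => by_contra fun hij => hinj i j hij h⟩, hadj _ _⟩⟩

/-- Suppose `a b p` is a triangle and `q c` is an edge, with `p q` the only edge from `q` to the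
triangle and with `c` adjacent to neither `a` nor `p`. In a hole-free and paraglider-free graph,
a vertex that sees `a`, `b` and `c` also sees `p`. -/
lemma adj_of_adj_triangle_edge (hHole : HoleFree G) (hPara : ¬ HasInducedCopy G paraglider)
    {a b c p q v : V} (hab : G.Adj a b) (hap : G.Adj a p) (hbp : G.Adj b p) (hpq : G.Adj p q)
    (hqc : G.Adj q c) (haq : ¬ G.Adj a q) (hbq : ¬ G.Adj b q) (hac : ¬ G.Adj a c)
    (hpc : ¬ G.Adj p c) (hva : G.Adj v a) (hvb : G.Adj v b) (hvc : G.Adj v c) (hvp : v ≠ p) :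
    G.Adj v p := by
  by_contra h
  have hqa : q ≠ a := by rintro rfl; exact hbq hab.symm
  have hqb : q ≠ b := by rintro rfl; exact haq hab
  have hqv : q ≠ v := by rintro rfl; exact h hpq.symm
  have hac' : a ≠ c := by rintro rfl; exact hpc hap.symm
  have hpc' : p ≠ c := by rintro rfl; exact h hvc
  have hqa' : ¬ G.Adj q a := fun h' => haq h'.symm
  have hqb' : ¬ G.Adj q b := fun h' => hbq h'.symm
  have hca : ¬ G.Adj c a := fun h' => hac h'.symm
  have hcp : ¬ G.Adj c p := fun h' => hpc h'.symm
  have hpv : ¬ G.Adj p v := fun h' => h h'.symm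
  by_cases hvq : G.Adj v q
  · refine hPara (hasInducedCopy_of_adj_iff ![a, b, v, p, q] ?_ ?_)
    · intro i j hij
      fin_cases i <;> fin_cases j <;>
        simp [hab.ne, hab.ne', hap.ne, hap.ne', hbp.ne, hbp.ne', hva.ne, hva.ne', hvb.ne,
          hvb.ne', hpq.ne, hpq.ne', hvp, hvp.symm, hqa, hqa.symm, hqb, hqb.symm, hqv,
          hqv.symm] at hij ⊢
    · intro i j
      fin_cases i <;> fin_cases j <;>
        simp [paraglider, hab, hab.symm, hap, hap.symm, hbp, hbp.symm, hva, hva.symm, hvb,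
          hvb.symm, hpq, hpq.symm, hvq, hvq.symm, h, hpv, haq, hqa', hbq, hqb']
  · have hqv' : ¬ G.Adj q v := fun h' => hvq h'.symm
    have hcycle (i j : Fin 5) : (cycleGraph 5).Adj i j ↔ j = i + 1 ∨ i = j + 1 := by
      revert i j; decide
    refine hHole 5 le_rfl (hasInducedCopy_of_adj_iff ![v, a, p, q, c] ?_ ?_)
    · intro i j hij
      fin_cases i <;> fin_cases j <;>
        simp [hap.ne, hap.ne', hqc.ne, hqc.ne', hva.ne, hva.ne', hvc.ne, hvc.ne', hpq.ne,
          hpq.ne', hvp, hvp.symm, hqa, hqa.symm, hqv, hqv.symm, hac', hac'.symm, hpc',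
          hpc'.symm] at hij ⊢
    · intro i j
      rw [hcycle]
      fin_cases i <;> fin_cases j <;>
        simp [hap, hap.symm, hqc, hqc.symm, hva, hva.symm, hvc, hvc.symm, hpq, hpq.symm, h, hpv,
          hvq, hqv', haq, hqa', hac, hca, hpc, hcp]

end

/-- every vertex seeing all of `A` is total w.r.t. a maximal matched
co-bipartite induced subgraph `A*` containing `A`. -/
theorem A6_total_wrt_Astar {V : Type} (G : SimpleGraph V)
    (hHole : HoleFree G) (hPara : ¬ HasInducedCopy G paraglider)
    (f : (cycleGraph 6)ᶜ ↪g G)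
    (B : Set V) (hAB : Set.range ⇑f ⊆ B)
    (k : ℕ) (hB : Nonempty (G.induce B ≃g matchedCoBip k))
    (hmax : ∀ B' : Set V, B ⊆ B' →
      (∃ k' : ℕ, Nonempty (G.induce B' ≃g matchedCoBip k')) → B' = B)
    (v : V) (hv : ∀ i : Fin 6, G.Adj v (f i)) :
    ∀ w ∈ B, v ≠ w → G.Adj v w := by
  obtain ⟨e⟩ := hB
  let F : matchedCoBip k ↪g G := e.symm.toEmbedding.trans (Embedding.induce B)
  let g : (cycleGraph 6)ᶜ ↪g matchedCoBip k :=
    { toFun := fun i => e ⟨f i, hAB ⟨i, rfl⟩⟩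
      inj' := fun i j hij => f.injective (congrArg Subtype.val (e.injective hij))
      map_rel_iff' := e.map_rel_iff.trans f.map_rel_iff }
  have hFg (x) (hx : x ∈ Set.range g) : G.Adj v (F x) := by
    obtain ⟨i, rfl⟩ := hx
    have : F (g i) = f i := congrArg Subtype.val (e.symm_apply_apply _)
    exact this ▸ hv i
  obtain ⟨i, j, hij, hi, hi', hj, hj'⟩ := matchedCoBip.exists_matching_edges g
  have key (x) (hx : v ≠ F x) : G.Adj v (F x) := by
    rcases x with m | m
    · by_cases hmi : m = i
      · exact hmi ▸ hFg _ hi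
      by_cases hmj : m = j
      · exact hmj ▸ hFg _ hj
      refine adj_of_adj_triangle_edge hHole hPara (a := F (.inl i)) (b := F (.inl j)) (c := F (.inr j))
        (q := F (.inr m)) ?_ ?_ ?_ ?_ ?_ ?_ ?_ ?_ ?_ (hFg _ hi) (hFg _ hj) (hFg _ hj') hx <;>
        rw [F.map_adj_iff] <;> simp [hij, hmj, Ne.symm hmi, Ne.symm hmj]
    · by_cases hmi : m = i
      · exact hmi ▸ hFg _ hi'
      by_cases hmj : m = j
      · exact hmj ▸ hFg _ hj'
      refine adj_of_adj_triangle_edge hHole hPara (a := F (.inr i)) (b := F (.inr j)) (c := F (.inl j))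
        (q := F (.inl m)) ?_ ?_ ?_ ?_ ?_ ?_ ?_ ?_ ?_ (hFg _ hi') (hFg _ hj') (hFg _ hj) hx <;>
        rw [F.map_adj_iff] <;> simp [hij, hmj, Ne.symm hmi, Ne.symm hmj]
  intro w hw hvw
  have hFw : F (e ⟨w, hw⟩) = w := congrArg Subtype.val (e.symm_apply_apply _)
  exact hFw ▸ key _ (by rwa [hFw])
end

section
/- Let G be a hole-free and paraglider-free graph that is an atom (has no clique separator) and contains an induced copy A of the complement of C6. Let x ∈ left(A), y ∈ right(A) with xy a matching edge of A. Then no vertex outside A has neighborhood in A exactly equal to {x, y}, and there is no edge uv with u, v outside A, N_A(u) = {x}, and N_A(v) = {y}. -/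
open SimpleGraph

/-- There is a chordless path with `m` edges from `p` to `q` whose interior lies in `S`. -/
def HasInducedPath {V : Type} (G : SimpleGraph V) (S : Set V) (p q : V) (m : ℕ) : Prop :=
  ∃ P : ℕ → V, P 0 = p ∧ P m = q ∧ (∀ i, 0 < i → i < m → P i ∈ S) ∧
    ∀ i j, i < j → j ≤ m → P i ≠ P j ∧ (G.Adj (P i) (P j) ↔ j = i + 1)

/-- There is a walk with `m` edges from `p` to `q` whose interior lies in `S`. -/
def HasWalkThrough {V : Type} (G : SimpleGraph V) (S : Set V) (p q : V) (m : ℕ) : Prop :=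
  ∃ P : ℕ → V, P 0 = p ∧ P m = q ∧ (∀ i, 0 < i → i < m → P i ∈ S) ∧
    ∀ i, i < m → G.Adj (P i) (P (i + 1))

theorem hasInducedPath_of_hasWalkThrough {V : Type} {G : SimpleGraph V} {S : Set V} {p q : V}
    (hpq : p ≠ q) (hnadj : ¬ G.Adj p q) (h : ∃ m, HasWalkThrough G S p q m) :
    ∃ m, 2 ≤ m ∧ HasInducedPath G S p q m := by
  classical
  obtain ⟨P, h0, hm, hS, hadj⟩ := Nat.find_spec h
  have hmin : ∀ k, k < Nat.find h → ¬ HasWalkThrough G S p q k := fun k hk => Nat.find_min h hk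
  generalize Nat.find h = m at *
  refine ⟨m, ?_, P, h0, hm, hS, fun i j hij hjm => ⟨fun heq => ?_, fun hA => ?_, fun hj => ?_⟩⟩
  · by_contra hlt
    have : m = 0 ∨ m = 1 := by omega
    rcases this with rfl | rfl
    · exact hpq (h0.symm.trans hm)
    · have := hadj 0 (by omega)
      simp only [zero_add, h0, hm] at this
      exact hnadj this
  · refine hmin (m - (j - i)) (by omega)
      ⟨fun k => if k ≤ i then P k else P (k + (j - i)), by simp [h0], ?_, ?_, ?_⟩
    · by_cases hjm' : j = m
      · subst hjm'
        simp [show j - (j - i) = i by omega, heq, hm]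
      · have h1 : ¬ m - (j - i) ≤ i := by omega
        have h2 : m - (j - i) + (j - i) = m := by omega
        simp [h1, h2, hm]
    · intro k hk hkm
      dsimp only
      split_ifs
      · exact hS k hk (by omega)
      · exact hS _ (by omega) (by omega)
    · intro k hk
      dsimp only
      by_cases h1 : k + 1 ≤ i
      · rw [if_pos (by omega), if_pos h1]
        exact hadj k (by omega)
      · rw [if_neg h1]
        by_cases h2 : k = i
        · subst h2
          rw [if_pos le_rfl, heq, show k + 1 + (j - k) = j + 1 by omega]
          exact hadj j (by omega)
        · rw [if_neg (by omega), show k + 1 + (j - i) = k + (j - i) + 1 by omega]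
          exact hadj _ (by omega)
  · by_contra hne
    refine hmin (m - (j - i - 1)) (by omega)
      ⟨fun k => if k ≤ i then P k else P (k + (j - i - 1)), by simp [h0], ?_, ?_, ?_⟩
    · have h1 : ¬ m - (j - i - 1) ≤ i := by omega
      have h2 : m - (j - i - 1) + (j - i - 1) = m := by omega
      simp [h1, h2, hm]
    · intro k hk hkm
      dsimp only
      split_ifs
      · exact hS k hk (by omega)
      · exact hS _ (by omega) (by omega)
    · intro k hk
      dsimp only
      by_cases h1 : k + 1 ≤ i
      · rw [if_pos (by omega), if_pos h1]
        exact hadj k (by omega)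
      · rw [if_neg h1]
        by_cases h2 : k = i
        · subst h2
          rw [if_pos le_rfl, show k + 1 + (j - k - 1) = j by omega]
          exact hA
        · rw [if_neg (by omega), show k + 1 + (j - i - 1) = k + (j - i - 1) + 1 by omega]
          exact hadj _ (by omega)
  · subst hj
    exact hadj i (by omega)

theorem hasWalkThrough_of_reachable {V : Type} {G : SimpleGraph V} {S : Set V} {p q : V}
    {a b : S} (hab : (G.induce S).Reachable a b) (hpa : G.Adj p a) (hqb : G.Adj q b) :
    ∃ m, HasWalkThrough G S p q m := by
  obtain ⟨W⟩ := hab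
  refine ⟨W.length + 2, fun i => if i = 0 then p else if i = W.length + 2 then q
    else (W.getVert (i - 1)).1, by simp, by simp, fun i hi him => ?_, fun i hi => ?_⟩
  · dsimp only
    rw [if_neg (by omega), if_neg (by omega)]
    exact (W.getVert (i - 1)).2
  · dsimp only
    rw [if_neg (show i + 1 ≠ 0 by omega), if_neg (show i ≠ W.length + 2 by omega)]
    by_cases h0 : i = 0
    · subst h0
      simpa using hpa
    · rw [if_neg h0]
      by_cases hl : i = W.length + 1
      · subst hl
        simpa using hqb.symm
      · rw [if_neg (by omega)]
        have := W.adj_getVert_succ (i := i - 1) (by omega)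
        rw [show i - 1 + 1 = i by omega] at this
        simpa using this

theorem HasInducedPath.snoc {V : Type} {G : SimpleGraph V} {S : Set V} {p q r : V} {m : ℕ}
    (h : HasInducedPath G S p q m) (hS : ∀ s ∈ S, ¬ G.Adj s r) (hrS : r ∉ S)
    (hp : p = q ∨ ¬ G.Adj p r) (hpr : p ≠ r) (hq : G.Adj q r) :
    HasInducedPath G (insert q S) p r (m + 1) := by
  obtain ⟨P, h0, hm, hi, hP⟩ := h
  refine ⟨fun i => if i ≤ m then P i else r, by simp [h0], by simp, fun i h1 h2 => ?_,
    fun i j hij hj => ?_⟩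
  · dsimp only
    rw [if_pos (by omega)]
    by_cases him : i = m
    · exact Or.inl (him ▸ hm)
    · exact Or.inr (hi i h1 (by omega))
  · dsimp only
    rw [if_pos (show i ≤ m by omega)]
    by_cases hjm : j ≤ m
    · rw [if_pos hjm]
      exact hP i j hij hjm
    · rw [if_neg hjm]
      obtain rfl : j = m + 1 := by omega
      by_cases him : i = m
      · subst him
        rw [hm]
        exact ⟨hq.ne, by simp [hq]⟩
      · by_cases hi0 : i = 0
        · subst hi0
          rw [h0]
          have := (hP 0 m (by omega) le_rfl).1
          rw [h0, hm] at this
          exact ⟨hpr, by simp [hp.resolve_left this]; omega⟩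
        · have hiS := hi i (by omega) (by omega)
          exact ⟨fun h => hrS (h ▸ hiS), by simp [hS _ hiS]; omega⟩

theorem cycleGraph_adj_of_lt {n : ℕ} {i j : Fin n} (hij : i < j) :
    (cycleGraph n).Adj i j ↔ j.val = i.val + 1 ∨ (i.val = 0 ∧ j.val + 1 = n) := by
  have hlt : i.val < j.val := hij
  have hj := j.2
  rw [cycleGraph_adj', Fin.sub_val_of_le hij.le, Fin.val_sub]
  rw [Nat.mod_eq_of_lt (by omega)]
  omega

theorem HoleFree.false_of_close {V : Type} {G : SimpleGraph V} (hH : HoleFree G) {S : Set V}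
    {p q r : V} {m : ℕ} (h : HasInducedPath G S p q m) (hm3 : 3 ≤ m)
    (hS : ∀ s ∈ S, ¬ G.Adj s r) (hrS : r ∉ S) (hp : G.Adj p r) (hq : G.Adj q r) : False := by
  obtain ⟨P, h0, hm, hi, hP⟩ := h
  have key : ∀ i j : Fin (m + 2), i < j →
      (if i.val ≤ m then P i else r) ≠ (if j.val ≤ m then P j else r) ∧
      (G.Adj (if i.val ≤ m then P i else r) (if j.val ≤ m then P j else r) ↔
        (cycleGraph (m + 2)).Adj i j) := by
    intro i j hij
    rw [cycleGraph_adj_of_lt hij]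
    have hlt : i.val < j.val := hij
    have hj := j.2
    rw [if_pos (by omega)]
    by_cases hjm : j.val ≤ m
    · rw [if_pos hjm]
      obtain ⟨h1, h2⟩ := hP i j hlt hjm
      exact ⟨h1, by rw [h2]; omega⟩
    · rw [if_neg hjm]
      by_cases him : i.val = m
      · rw [him, hm]
        exact ⟨hq.ne, iff_of_true hq (by omega)⟩
      · by_cases hi0 : i.val = 0
        · rw [hi0, h0]
          exact ⟨hp.ne, iff_of_true hp (by omega)⟩
        · have hiS := hi i (by omega) (by omega)
          exact ⟨fun h => hrS (h ▸ hiS), iff_of_false (hS _ hiS) (by omega)⟩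
  refine hH (m + 2) (by omega) ⟨⟨⟨fun i => if i.val ≤ m then P i else r, ?_⟩, ?_⟩⟩
  · intro i j hij
    by_contra hne
    rcases lt_or_gt_of_ne hne with h | h
    · exact (key i j h).1 hij
    · exact (key j i h).1 hij.symm
  · intro i j
    rcases lt_trichotomy i j with h | h | h
    · exact (key i j h).2
    · subst h
      simp
    · rw [G.adj_comm, (cycleGraph (m + 2)).adj_comm]
      exact (key j i h).2

theorem false_of_paraglider {V : Type} {G : SimpleGraph V}
    (hPara : ¬ HasInducedCopy G paraglider) {a b c d e : V}
    (hab : G.Adj a b) (hac : G.Adj a c) (had : G.Adj a d) (hbc : G.Adj b c) (hbd : G.Adj b d)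
    (hec : G.Adj e c) (hed : G.Adj e d) (hcd : ¬ G.Adj c d) (hcd' : c ≠ d)
    (hea : ¬ G.Adj e a) (heb : ¬ G.Adj e b) : False := by
  have hae : a ≠ e := by rintro rfl; exact heb hab
  have hbe : b ≠ e := by rintro rfl; exact hea hab.symm
  have := hab.ne
  have := hac.ne
  have := had.ne
  have := hbc.ne
  have := hbd.ne
  have := hec.ne
  have := hed.ne
  refine hPara ⟨⟨⟨![a, b, c, d, e], ?_⟩, ?_⟩⟩
  · intro i j
    fin_cases i <;> fin_cases j <;> simp <;> grind
  · intro i j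
    change G.Adj (![a, b, c, d, e] i) (![a, b, c, d, e] j) ↔ _
    fin_cases i <;> fin_cases j <;> simp [paraglider, fromRel_adj, G.adj_comm] <;>
      grind [SimpleGraph.adj_comm]

/-- Two nonadjacent vertices with two adjacent common neighbours cannot be linked through a set
that these common neighbours miss. -/
theorem HasInducedPath.false_of_diamond {V : Type} {G : SimpleGraph V} (hH : HoleFree G)
    (hPara : ¬ HasInducedCopy G paraglider) {S : Set V} {p q r s : V} {m : ℕ} (hm : 2 ≤ m)
    (h : HasInducedPath G S p q m) (hrs : G.Adj r s) (hpr : G.Adj p r) (hqr : G.Adj q r)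
    (hps : G.Adj p s) (hqs : G.Adj q s) (hSr : ∀ t ∈ S, ¬ G.Adj t r)
    (hSs : ∀ t ∈ S, ¬ G.Adj t s) (hrS : r ∉ S) : False := by
  by_cases hm3 : 3 ≤ m
  · exact hH.false_of_close h hm3 hSr hrS hpr hqr
  · obtain rfl : m = 2 := by omega
    obtain ⟨P, rfl, rfl, hi, hP⟩ := h
    have hc := hi 1 (by omega) (by omega)
    have h01 := (hP 0 1 (by omega) (by omega)).2.2 rfl
    have h12 := (hP 1 2 (by omega) (by omega)).2.2 rfl
    have h02 := hP 0 2 (by omega) (by omega)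
    exact false_of_paraglider hPara hrs hpr.symm hqr.symm hps.symm hqs.symm h01.symm h12
      (fun h => by simpa using h02.2.1 h) h02.1 (hSr _ hc) (hSs _ hc)

/-- The vertices `x, x₁, x₂, y, y₁, y₂` induce two triangles joined by the perfect matching
`xy, x₁y₁, x₂y₂`. -/
structure IsPrism {V : Type} (G : SimpleGraph V) (x x₁ x₂ y y₁ y₂ : V) : Prop where
  xx₁ : G.Adj x x₁
  xx₂ : G.Adj x x₂
  x₁x₂ : G.Adj x₁ x₂
  yy₁ : G.Adj y y₁
  yy₂ : G.Adj y y₂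
  y₁y₂ : G.Adj y₁ y₂
  xy : G.Adj x y
  x₁y₁ : G.Adj x₁ y₁
  x₂y₂ : G.Adj x₂ y₂
  xy₁ : ¬ G.Adj x y₁
  xy₂ : ¬ G.Adj x y₂
  x₁y : ¬ G.Adj x₁ y
  x₁y₂ : ¬ G.Adj x₁ y₂
  x₂y : ¬ G.Adj x₂ y
  x₂y₁ : ¬ G.Adj x₂ y₁

theorem IsPrism.swapSides {V : Type} {G : SimpleGraph V} {x x₁ x₂ y y₁ y₂ : V}
    (h : IsPrism G x x₁ x₂ y y₁ y₂) : IsPrism G y y₁ y₂ x x₁ x₂ := by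
  obtain ⟨⟩ := h
  constructor <;> grind [SimpleGraph.adj_comm]

theorem IsPrism.swapEdges {V : Type} {G : SimpleGraph V} {x x₁ x₂ y y₁ y₂ : V}
    (h : IsPrism G x x₁ x₂ y y₁ y₂) : IsPrism G x x₂ x₁ y y₂ y₁ := by
  obtain ⟨⟩ := h
  constructor <;> grind [SimpleGraph.adj_comm]

/-- `S` is a set of vertices outside the prism, anticomplete to `{x₁, x₂, y₁, y₂}`. -/
structure IsRemote {V : Type} (G : SimpleGraph V) (S : Set V) (x x₁ x₂ y y₁ y₂ : V) : Prop where
  notMem_x : x ∉ S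
  notMem_x₁ : x₁ ∉ S
  notMem_x₂ : x₂ ∉ S
  notMem_y : y ∉ S
  notMem_y₁ : y₁ ∉ S
  notMem_y₂ : y₂ ∉ S
  adj_x₁ : ∀ s ∈ S, ¬ G.Adj s x₁
  adj_x₂ : ∀ s ∈ S, ¬ G.Adj s x₂
  adj_y₁ : ∀ s ∈ S, ¬ G.Adj s y₁
  adj_y₂ : ∀ s ∈ S, ¬ G.Adj s y₂

section Prism

variable {V : Type} {G : SimpleGraph V} {S : Set V} {x x₁ x₂ y y₁ y₂ : V}

theorem IsRemote.swapSides (h : IsRemote G S x x₁ x₂ y y₁ y₂) :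
    IsRemote G S y y₁ y₂ x x₁ x₂ :=
  ⟨h.notMem_y, h.notMem_y₁, h.notMem_y₂, h.notMem_x, h.notMem_x₁, h.notMem_x₂,
    h.adj_y₁, h.adj_y₂, h.adj_x₁, h.adj_x₂⟩

theorem IsRemote.swapEdges (h : IsRemote G S x x₁ x₂ y y₁ y₂) :
    IsRemote G S x x₂ x₁ y y₂ y₁ :=
  ⟨h.notMem_x, h.notMem_x₂, h.notMem_x₁, h.notMem_y, h.notMem_y₂, h.notMem_y₁,
    h.adj_x₂, h.adj_x₁, h.adj_y₂, h.adj_y₁⟩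

theorem IsPrism.ne (h : IsPrism G x x₁ x₂ y y₁ y₂) :
    x ≠ y₁ ∧ x ≠ y₂ ∧ x₁ ≠ y ∧ x₁ ≠ y₂ ∧ x₂ ≠ y ∧ x₂ ≠ y₁ := by
  obtain ⟨⟩ := h
  grind [SimpleGraph.adj_comm]

theorem IsPrism.not_adj_left_of_path (hA : IsPrism G x x₁ x₂ y y₁ y₂) (hH : HoleFree G)
    (hR : IsRemote G S x x₁ x₂ y y₁ y₂) {w : V} {m : ℕ} (hm : 2 ≤ m)
    (h : HasInducedPath G S w y m) (hy₁ : ¬ G.Adj w y₁) (hne : w ≠ y₁) : ¬ G.Adj w x₁ := by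
  intro hx₁
  have h' := h.snoc hR.adj_y₁ hR.notMem_y₁ (Or.inr hy₁) hne hA.yy₁
  refine hH.false_of_close h' (by omega) (r := x₁) ?_ ?_ hx₁ hA.x₁y₁.symm
  · rintro s (rfl | hs)
    · exact fun h => hA.x₁y h.symm
    · exact hR.adj_x₁ s hs
  · rintro (h | h)
    · exact hA.ne.2.2.1 h
    · exact hR.notMem_x₁ h

theorem IsPrism.not_adj_matched_of_path (hA : IsPrism G x x₁ x₂ y y₁ y₂) (hH : HoleFree G)
    (hR : IsRemote G S x x₁ x₂ y y₁ y₂) {w : V} {m : ℕ} (hm : 2 ≤ m)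
    (h : HasInducedPath G S w y m) (hy₂ : ¬ G.Adj w y₂) (hne : w ≠ y₂)
    (hx₂ : ¬ G.Adj w x₂) (hne' : w ≠ x₂) : ¬ G.Adj w x₁ := by
  intro hx₁
  obtain ⟨n1, n2, n3, n4, n5, n6⟩ := hA.ne
  have h' := h.snoc hR.adj_y₂ hR.notMem_y₂ (Or.inr hy₂) hne hA.yy₂
  have h'' := h'.snoc (r := x₂) (by
    rintro s (rfl | hs)
    · exact fun h => hA.x₂y h.symm
    · exact hR.adj_x₂ s hs) (by
    rintro (h | h)
    · exact n5 h
    · exact hR.notMem_x₂ h) (Or.inr hx₂) hne' hA.x₂y₂.symm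
  refine hH.false_of_close h'' (by omega) (r := x₁) ?_ ?_ hx₁ hA.x₁x₂.symm
  · rintro s (rfl | rfl | hs)
    · exact fun h => hA.x₁y₂ h.symm
    · exact fun h => hA.x₁y h.symm
    · exact hR.adj_x₁ s hs
  · rintro (h | h | h)
    · exact n4 h
    · exact n3 h
    · exact hR.notMem_x₁ h

theorem IsPrism.not_diagonal (hA : IsPrism G x x₁ x₂ y y₁ y₂) (hH : HoleFree G) {w : V}
    (hx : G.Adj w x) (hy₁ : G.Adj w y₁) (hx₂ : ¬ G.Adj w x₂) (hy₂ : ¬ G.Adj w y₂)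
    (hne₁ : w ≠ x₂) (hne₂ : w ≠ y₂) : False := by
  obtain ⟨n1, n2, n3, n4, n5, n6⟩ := hA.ne
  have h1 : HasInducedPath G ∅ w x 1 :=
    ⟨fun i => if i = 0 then w else x, by simp, by simp, fun i h1 h2 => by omega,
      fun i j h1 h2 => by
        obtain rfl : i = 0 := by omega
        obtain rfl : j = 1 := by omega
        simp [hx, hx.ne]⟩
  have h2 := h1.snoc (r := x₂) (by simp) (by simp) (Or.inr hx₂) hne₁ hA.xx₂
  have h3 := h2.snoc (r := y₂)
    (by rintro s (rfl | ⟨⟨⟩⟩); exact hA.xy₂) (by rintro (h | ⟨⟨⟩⟩); exact n2 h.symm)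
    (Or.inr hy₂) hne₂ hA.x₂y₂
  refine hH.false_of_close h3 (by omega) (r := y₁) ?_ ?_ hy₁ hA.y₁y₂.symm
  · rintro s (rfl | rfl | ⟨⟨⟩⟩)
    · exact hA.x₂y₁
    · exact hA.xy₁
  · rintro (h | h | ⟨⟨⟩⟩)
    · exact n6 h.symm
    · exact n1 h.symm

theorem IsPrism.adj_of_linked (hA : IsPrism G x x₁ x₂ y y₁ y₂) (hH : HoleFree G)
    (hPara : ¬ HasInducedCopy G paraglider) (hR : IsRemote G S x x₁ x₂ y y₁ y₂) {w : V}
    (hw : w ∉ ({x, x₁, x₂, y, y₁, y₂} : Set V))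
    (hw' : G.Adj w x₁ ∨ G.Adj w x₂ ∨ G.Adj w y₁ ∨ G.Adj w y₂)
    (hlx : ∃ m, HasWalkThrough G S w x m) (hly : ∃ m, HasWalkThrough G S w y m) :
    G.Adj w y := by
  by_contra hy
  simp only [Set.mem_insert_iff, Set.mem_singleton_iff, not_or] at hw
  obtain ⟨nx, nx₁, nx₂, ny, ny₁, ny₂⟩ := hw
  obtain ⟨m, hm, hP⟩ := hasInducedPath_of_hasWalkThrough ny hy hly
  have l₁ := fun h => hA.not_adj_left_of_path hH hR hm hP h ny₁
  have l₂ := fun h => hA.swapEdges.not_adj_left_of_path hH hR.swapEdges hm hP h ny₂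
  have r₁ := fun h h' => hA.not_adj_matched_of_path hH hR hm hP h ny₂ h' nx₂
  have r₂ := fun h h' =>
    hA.swapEdges.not_adj_matched_of_path hH hR.swapEdges hm hP h ny₁ h' nx₁
  have d : ¬ (G.Adj w y₁ ∧ G.Adj w y₂) := fun h =>
    hP.false_of_diamond hH hPara hm hA.y₁y₂ h.1 hA.yy₁ h.2 hA.yy₂ hR.adj_y₁ hR.adj_y₂ hR.notMem_y₁
  by_cases hx : G.Adj w x
  · have c₁ := fun h h' h'' => hA.not_diagonal hH hx h h' h'' nx₂ ny₂
    have c₂ := fun h h' h'' => hA.swapEdges.not_diagonal hH hx h h' h'' nx₁ ny₁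
    grind
  · obtain ⟨k, hk, hQ⟩ := hasInducedPath_of_hasWalkThrough nx hx hlx
    have s₁ := fun h => hA.swapSides.not_adj_left_of_path hH hR.swapSides hk hQ h nx₁
    have s₂ := fun h =>
      hA.swapSides.swapEdges.not_adj_left_of_path hH hR.swapSides.swapEdges hk hQ h nx₂
    grind

theorem IsPrism.adj_iff (hA : IsPrism G x x₁ x₂ y y₁ y₂)
    (hPara : ¬ HasInducedCopy G paraglider) {w : V} (hx : G.Adj w x) (hy : G.Adj w y) :
    G.Adj w x₁ ↔ G.Adj w y₁ := by
  constructor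
  · intro h
    by_contra h'
    exact false_of_paraglider hPara hx h hy hA.xx₁ hA.xy hA.x₁y₁.symm hA.yy₁.symm hA.x₁y
      hA.ne.2.2.1 (fun h => h' h.symm) (fun h => hA.xy₁ h.symm)
  · intro h
    by_contra h'
    exact false_of_paraglider hPara hy h hx hA.yy₁ hA.xy.symm hA.x₁y₁ hA.xx₁.symm
      (fun h => hA.xy₁ h.symm) hA.ne.1.symm (fun h => h' h.symm) hA.x₁y

theorem IsPrism.adj_of_linked_pair (hA : IsPrism G x x₁ x₂ y y₁ y₂) (hH : HoleFree G)
    (hPara : ¬ HasInducedCopy G paraglider) (hR : IsRemote G S x x₁ x₂ y y₁ y₂) {w w' : V}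
    (hw : w ∉ ({x, x₁, x₂, y, y₁, y₂} : Set V)) (hw' : w' ∉ ({x, x₁, x₂, y, y₁, y₂} : Set V))
    (hx : G.Adj w x) (hy : G.Adj w y) (hx' : G.Adj w' x) (hy' : G.Adj w' y)
    (hor : G.Adj w x₁ ∨ G.Adj w x₂ ∨ G.Adj w y₁ ∨ G.Adj w y₂)
    (hor' : G.Adj w' x₁ ∨ G.Adj w' x₂ ∨ G.Adj w' y₁ ∨ G.Adj w' y₂)
    (hne : w ≠ w') (hl : ∃ m, HasWalkThrough G S w w' m) : G.Adj w w' := by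
  by_contra hadj
  simp only [Set.mem_insert_iff, Set.mem_singleton_iff, not_or] at hw hw'
  obtain ⟨m, hm, hP⟩ := hasInducedPath_of_hasWalkThrough hne hadj hl
  have e₁ := hA.adj_iff hPara hx hy
  have e₂ := hA.swapEdges.adj_iff hPara hx hy
  have e₁' := hA.adj_iff hPara hx' hy'
  have e₂' := hA.swapEdges.adj_iff hPara hx' hy'
  by_cases h₁ : G.Adj w x₁ ∧ G.Adj w' x₁
  · exact hP.false_of_diamond hH hPara hm hA.x₁y₁ h₁.1 h₁.2 (e₁.1 h₁.1) (e₁'.1 h₁.2)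
      hR.adj_x₁ hR.adj_y₁ hR.notMem_x₁
  by_cases h₂ : G.Adj w x₂ ∧ G.Adj w' x₂
  · exact hP.false_of_diamond hH hPara hm hA.x₂y₂ h₂.1 h₂.2 (e₂.1 h₂.1) (e₂'.1 h₂.2)
      hR.adj_x₂ hR.adj_y₂ hR.notMem_x₂
  have hcase : (G.Adj w x₁ ∧ ¬ G.Adj w x₂ ∧ G.Adj w' x₂ ∧ ¬ G.Adj w' x₁) ∨
      (G.Adj w x₂ ∧ ¬ G.Adj w x₁ ∧ G.Adj w' x₁ ∧ ¬ G.Adj w' x₂) := by grind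
  rcases hcase with ⟨a, b, c, d⟩ | ⟨a, b, c, d⟩
  · have h' := hP.snoc hR.adj_x₂ hR.notMem_x₂ (Or.inr b) hw.2.2.1 c
    refine hH.false_of_close h' (by omega) (r := x₁) ?_ ?_ a hA.x₁x₂.symm
    · rintro s (rfl | hs)
      · exact d
      · exact hR.adj_x₁ s hs
    · rintro (h | h)
      · exact hw'.2.1 h.symm
      · exact hR.notMem_x₁ h
  · have h' := hP.snoc hR.adj_x₁ hR.notMem_x₁ (Or.inr b) hw.2.1 c
    refine hH.false_of_close h' (by omega) (r := x₂) ?_ ?_ a hA.x₁x₂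
    · rintro s (rfl | hs)
      · exact d
      · exact hR.adj_x₂ s hs
    · rintro (h | h)
      · exact hw'.2.2.1 h.symm
      · exact hR.notMem_x₂ h

/-- In an atom, no connected set that is remote from a prism sees both ends of the matching edge
`xy`. -/
theorem IsPrism.not_reachable (hA : IsPrism G x x₁ x₂ y y₁ y₂) (hH : HoleFree G)
    (hPara : ¬ HasInducedCopy G paraglider) (hAtom : IsAtomGraph G)
    (hS : S = {v | v ∉ ({x, x₁, x₂, y, y₁, y₂} : Set V) ∧
      ¬ (G.Adj v x₁ ∨ G.Adj v x₂ ∨ G.Adj v y₁ ∨ G.Adj v y₂)}) {u v : S}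
    (huv : (G.induce S).Reachable u v) (hu : G.Adj u x) (hv : G.Adj v y) : False := by
  have hR : IsRemote G S x x₁ x₂ y y₁ y₂ := by
    subst hS
    constructor <;> simp <;> tauto
  let C : Set V := {a | ∃ h : a ∈ S, (G.induce S).Reachable u ⟨a, h⟩}
  let K : Set V := {w | w ∉ C ∧ ∃ c ∈ C, G.Adj w c}
  have hlink : ∀ {p q c d : V}, c ∈ C → d ∈ C → G.Adj p c → G.Adj q d →
      ∃ m, HasWalkThrough G S p q m := by
    rintro p q c d ⟨hc, hc'⟩ ⟨hd, hd'⟩ hp hq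
    exact hasWalkThrough_of_reachable (hc'.symm.trans hd') hp hq
  have huC : (u : V) ∈ C := ⟨u.2, Reachable.refl _⟩
  have hvC : (v : V) ∈ C := ⟨v.2, huv⟩
  have hKS : ∀ w ∈ K, w ∉ S := by
    rintro w ⟨hw, c, ⟨hc, hc'⟩, hwc⟩ hwS
    refine hw ⟨hwS, hc'.trans (Adj.reachable ?_)⟩
    exact hwc.symm
  have hK : ∀ w ∈ K, w = x ∨ w = y ∨ (w ∉ ({x, x₁, x₂, y, y₁, y₂} : Set V) ∧
      (G.Adj w x₁ ∨ G.Adj w x₂ ∨ G.Adj w y₁ ∨ G.Adj w y₂) ∧ G.Adj w x ∧ G.Adj w y) := by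
    intro w hw
    obtain ⟨hwC, c, hc, hwc⟩ := id hw
    have hwS := hKS w hw
    have hcS : c ∈ S := hc.1
    by_cases hwA : w ∈ ({x, x₁, x₂, y, y₁, y₂} : Set V)
    · rcases hwA with rfl | rfl | rfl | rfl | rfl | rfl
      · exact Or.inl rfl
      · exact (hR.adj_x₁ c hcS hwc.symm).elim
      · exact (hR.adj_x₂ c hcS hwc.symm).elim
      · exact Or.inr (Or.inl rfl)
      · exact (hR.adj_y₁ c hcS hwc.symm).elim
      · exact (hR.adj_y₂ c hcS hwc.symm).elim
    · have hor : G.Adj w x₁ ∨ G.Adj w x₂ ∨ G.Adj w y₁ ∨ G.Adj w y₂ := by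
        by_contra hno
        exact hwS (hS ▸ ⟨hwA, hno⟩)
      have hlx := hlink hc huC hwc hu.symm
      have hly := hlink hc hvC hwc hv.symm
      refine Or.inr (Or.inr ⟨hwA, hor, ?_, hA.adj_of_linked hH hPara hR hwA hor hlx hly⟩)
      refine hA.swapSides.adj_of_linked hH hPara hR.swapSides ?_ (by tauto) hly hlx
      simp only [Set.mem_insert_iff, Set.mem_singleton_iff] at hwA ⊢
      tauto
  refine hAtom.2 ⟨K, ?_, fun hpre => ?_⟩
  · intro w hw w' hw' hne
    obtain ⟨-, c, hc, hwc⟩ := id hw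
    obtain ⟨-, c', hc', hwc'⟩ := id hw'
    rcases hK w hw with rfl | rfl | ⟨hwA, hor, hx, hy⟩ <;>
      rcases hK w' hw' with rfl | rfl | ⟨hwA', hor', hx', hy'⟩
    · exact (hne rfl).elim
    · exact hA.xy
    · exact hx'.symm
    · exact hA.xy.symm
    · exact (hne rfl).elim
    · exact hy'.symm
    · exact hx
    · exact hy
    · exact hA.adj_of_linked_pair hH hPara hR hwA hwA' hx hy hx' hy' hor hor' hne
        (hlink hc hc' hwc hwc')
  · have hx₁K : x₁ ∉ K := by
      rintro ⟨-, c, hc, h⟩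
      exact hR.adj_x₁ c hc.1 h.symm
    have hclosed : ∀ a b : (Kᶜ : Set V), (G.induce Kᶜ).Reachable a b → a.1 ∈ C → b.1 ∈ C := by
      rintro a b ⟨W⟩
      induction W with
      | nil => exact id
      | cons h _ ih =>
        intro ha
        refine ih ?_
        by_contra hb
        exact (Subtype.prop _ : _ ∈ Kᶜ) ⟨hb, _, ha, h.symm⟩
    have := hclosed ⟨u, fun h => h.1 huC⟩ ⟨x₁, hx₁K⟩ (hpre _ _) huC
    exact hR.notMem_x₁ this.1

end Prism

theorem isPrism_of_embedding {V : Type} {G : SimpleGraph V} (f : (cycleGraph 6)ᶜ ↪g G)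
    (a : Fin 6) :
    IsPrism G (f a) (f (a + 2)) (f (a + 4)) (f (a + 3)) (f (a + 5)) (f (a + 1)) := by
  constructor <;> rw [f.map_adj_iff] <;> revert a <;> decide

/-- in an HP-free atom, for a matching edge `f a`–`f (a+3)` of the
`C₆`-complement `A`, the sets `A₂[xy]` and `A₁[xy]` are empty. -/
theorem atom_A1xy_A2xy_empty {V : Type} (G : SimpleGraph V)
    (hHole : HoleFree G) (hPara : ¬ HasInducedCopy G paraglider)
    (hAtom : IsAtomGraph G)
    (f : (cycleGraph 6)ᶜ ↪g G) (a : Fin 6) :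
    (¬ ∃ u : V, u ∉ Set.range ⇑f ∧ {i : Fin 6 | G.Adj u (f i)} = {a, a + 3}) ∧
    (¬ ∃ u v : V, u ∉ Set.range ⇑f ∧ v ∉ Set.range ⇑f ∧ G.Adj u v ∧
      {i : Fin 6 | G.Adj u (f i)} = {a} ∧ {i : Fin 6 | G.Adj v (f i)} = {a + 3}) := by
  have hA := isPrism_of_embedding f a
  have hmem : ∀ u : V, u ∉ Set.range ⇑f → {i : Fin 6 | G.Adj u (f i)} ⊆ {a, a + 3} →
      u ∈ {v | v ∉ ({f a, f (a + 2), f (a + 4), f (a + 3), f (a + 5), f (a + 1)} : Set V) ∧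
        ¬ (G.Adj v (f (a + 2)) ∨ G.Adj v (f (a + 4)) ∨ G.Adj v (f (a + 5)) ∨
          G.Adj v (f (a + 1)))} := by
    intro u hu hN
    refine ⟨?_, ?_⟩
    · rintro (rfl | rfl | rfl | rfl | rfl | rfl) <;> exact hu ⟨_, rfl⟩
    · have h2 : ∀ b : Fin 6, ¬ (b + 2 = b ∨ b + 2 = b + 3) := by decide
      have h4 : ∀ b : Fin 6, ¬ (b + 4 = b ∨ b + 4 = b + 3) := by decide
      have h5 : ∀ b : Fin 6, ¬ (b + 5 = b ∨ b + 5 = b + 3) := by decide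
      have h1 : ∀ b : Fin 6, ¬ (b + 1 = b ∨ b + 1 = b + 3) := by decide
      rintro (h | h | h | h)
      · exact h2 a (hN h)
      · exact h4 a (hN h)
      · exact h5 a (hN h)
      · exact h1 a (hN h)
  refine ⟨?_, ?_⟩
  · rintro ⟨u, hu, hN⟩
    have hx : G.Adj u (f a) := hN.symm.subset (Or.inl rfl)
    have hy : G.Adj u (f (a + 3)) := hN.symm.subset (Or.inr rfl)
    exact hA.not_reachable hHole hPara hAtom rfl (u := ⟨u, hmem u hu hN.subset⟩)
      (Reachable.refl _) hx hy
  · rintro ⟨u, v, hu, hv, huv, hNu, hNv⟩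
    have hx : G.Adj u (f a) := hNu.symm.subset rfl
    have hy : G.Adj v (f (a + 3)) := hNv.symm.subset rfl
    refine hA.not_reachable hHole hPara hAtom rfl
      (u := ⟨u, hmem u hu (hNu.subset.trans (by simp))⟩)
      (v := ⟨v, hmem v hv (hNv.subset.trans (by simp))⟩) (Adj.reachable ?_) hx hy
    exact huv
end
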